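/- With the standard type A_θ hypotheses on (q_{st}) and the listed relations holding in the ℤ^θ-graded algebra B: (1) [x_{u_{ij}}, x_{u_{ip}}]_c = 0 for all 1 ≤ i ≤ j < p ≤ θ, and (2) [x_{u_{ij}}, x_{u_{pj}}]_c = 0 for all 1 ≤ i < p ≤ j ≤ θ. -/

import Mathlib

/-- The degree `e_i ∈ ℤ^θ` of the generator `x_i` (indices are 1-based, degrees are
modeled as finitely supported-looking functions `ℕ → ℤ`). -/
def evec (i : ℕ) : ℕ → ℤ := fun t => if t = i then 1 else 0

/-- The degree `u_{ij} = e_i + e_{i+1} + ⋯ + e_j ∈ ℤ^θ`. -/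
def uvec (i j : ℕ) : ℕ → ℤ := fun t => if i ≤ t ∧ t ≤ j then 1 else 0

/-- Braided commutator of (homogeneous) elements `u, v` of degrees `α, β`:
`[u, v]_c = uv − χ(α, β) vu`. -/
def bra {k : Type*} [Field k] {B : Type*} [Ring B] [Algebra k B]
    (χ : (ℕ → ℤ) → (ℕ → ℤ) → k) (α : ℕ → ℤ) (u : B) (β : ℕ → ℤ) (v : B) : B :=
  u * v - χ α β • (v * u)

/-- The iterated root vector `x_{u_{ij}}`, defined by `x_{u_{ii}} = x_i` and
`x_{u_{ij}} = [x_i, x_{u_{i+1,j}}]_c` for `i < j`. -/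
def xu {k : Type*} [Field k] {B : Type*} [Ring B] [Algebra k B]
    (χ : (ℕ → ℤ) → (ℕ → ℤ) → k) (x : ℕ → B) (i j : ℕ) : B :=
  if h : j ≤ i then x i
  else bra χ (evec i) (x i) (uvec (i + 1) j) (xu χ x (i + 1) j)
termination_by j - i
decreasing_by omega

section aux7
variable {k : Type*} [Field k] {B : Type*} [Ring B] [Algebra k B]

def C7 (χ : (ℕ → ℤ) → (ℕ → ℤ) → k) (α : ℕ → ℤ) (u : B) (β : ℕ → ℤ) (v : B) : Prop :=
  u * v = χ α β • (v * u)

lemma C7_iff (χ : (ℕ → ℤ) → (ℕ → ℤ) → k) (α : ℕ → ℤ) (u : B) (β : ℕ → ℤ) (v : B) :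
    bra χ α u β v = 0 ↔ C7 χ α u β v := by
  unfold bra C7; exact sub_eq_zero

lemma C7_flip {χ : (ℕ → ℤ) → (ℕ → ℤ) → k} {α : ℕ → ℤ} {u : B} {β : ℕ → ℤ} {v : B}
    (h : C7 χ α u β v) (h1 : χ α β * χ β α = 1) : C7 χ β v α u := by
  unfold C7 at *
  rw [h, smul_smul, mul_comm, h1, one_smul]

lemma C7_right {χ : (ℕ → ℤ) → (ℕ → ℤ) → k}
    (hχ₂ : ∀ a b c, χ a (b + c) = χ a b * χ a c)
    {α β γ : ℕ → ℤ} {a b c : B}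
    (h : C7 χ α a β b) (h' : C7 χ α a γ c) : C7 χ α a (β + γ) (bra χ β b γ c) := by
  unfold C7 bra at *
  have e1 : a * (b * c) = (χ α β * χ α γ) • (b * c * a) := by
    rw [← mul_assoc, h, smul_mul_assoc, mul_assoc b a c, h', mul_smul_comm, smul_smul, mul_assoc]
  have e2 : a * (c * b) = (χ α β * χ α γ) • (c * b * a) := by
    rw [← mul_assoc, h', smul_mul_assoc, mul_assoc c a b, h, mul_smul_comm, smul_smul, mul_assoc,
      mul_comm]
  rw [hχ₂, mul_sub, sub_mul, mul_smul_comm, smul_mul_assoc, e1, e2]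
  module

lemma C7_left {χ : (ℕ → ℤ) → (ℕ → ℤ) → k}
    (hχ₁ : ∀ a b c, χ (a + b) c = χ a c * χ b c)
    {α β γ : ℕ → ℤ} {a b c : B}
    (h : C7 χ β b α a) (h' : C7 χ γ c α a) : C7 χ (β + γ) (bra χ β b γ c) α a := by
  unfold C7 bra at *
  have e1 : b * c * a = (χ β α * χ γ α) • (a * (b * c)) := by
    rw [mul_assoc, h', mul_smul_comm, ← mul_assoc, h, smul_mul_assoc, smul_smul, mul_assoc,
      mul_comm]
  have e2 : c * b * a = (χ β α * χ γ α) • (a * (c * b)) := by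
    rw [mul_assoc, h, mul_smul_comm, ← mul_assoc, h', smul_mul_assoc, smul_smul, mul_assoc]
  rw [hχ₁, mul_sub, sub_mul, mul_smul_comm, smul_mul_assoc, e1, e2]
  module

lemma bra7_assoc {χ : (ℕ → ℤ) → (ℕ → ℤ) → k}
    (hχ₁ : ∀ a b c, χ (a + b) c = χ a c * χ b c)
    (hχ₂ : ∀ a b c, χ a (b + c) = χ a b * χ a c)
    {α β γ : ℕ → ℤ} {a b c : B} (h : C7 χ α a γ c) :
    bra χ α a (β + γ) (bra χ β b γ c) = bra χ (α + β) (bra χ α a β b) γ c := by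
  unfold C7 bra at *
  have e1 : a * (c * b) = χ α γ • (c * (a * b)) := by
    rw [← mul_assoc, h, smul_mul_assoc, mul_assoc]
  have e2 : b * (a * c) = χ α γ • (b * (c * a)) := by
    rw [h, mul_smul_comm]
  rw [hχ₁, hχ₂]
  simp only [mul_sub, sub_mul, mul_smul_comm, smul_mul_assoc, mul_assoc, e1, e2]
  module

lemma serre7 {χ : (ℕ → ℤ) → (ℕ → ℤ) → k}
    (hχ₁ : ∀ a b c, χ (a + b) c = χ a c * χ b c)
    (hχ₂ : ∀ a b c, χ a (b + c) = χ a b * χ a c)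
    {α β : ℕ → ℤ} {a b : B}
    (h : bra χ β b (β + α) (bra χ β b α a) = 0)
    (hc : (χ β β = -1 ∧ b ^ 2 = 0) ∨ χ β β * (χ α β * χ β α) = 1) :
    C7 χ (α + β) (bra χ α a β b) β b := by
  unfold C7
  unfold bra at *
  rw [hχ₁]
  rw [hχ₂] at h
  simp only [mul_sub, sub_mul, mul_smul_comm, smul_mul_assoc, mul_assoc] at h ⊢
  rcases hc with ⟨h1, h2⟩ | h1
  · rw [pow_two] at h2
    have h3 : b * (b * a) = 0 := by rw [← mul_assoc, h2, zero_mul]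
    rw [h1, h2, h3]
    simp only [mul_zero]
    module
  · have key : a * (b * b) - χ α β • (b * (a * b)) - (χ α β * χ β β) • (b * (a * b) - χ α β • (b * (b * a))) = (χ α β * χ α β * χ β β) • (b * (b * a) - χ β α • (b * (a * b)) - (χ β β * χ β α) • (b * (a * b) - χ β α • (a * (b * b)))) := by
      have e1 : χ α β * χ α β * χ β β * χ β α = χ α β := by linear_combination χ α β * h1
      have e2 : χ α β * χ α β * χ β β * (χ β β * χ β α) = χ α β * χ β β := by
        linear_combination χ α β * χ β β * h1
      have e3 : χ α β * χ β β * χ β α = 1 := by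
        linear_combination h1
      simp only [smul_sub, smul_smul, ← mul_assoc (χ α β * χ α β * χ β β)] at *
      simp only [← mul_assoc] at *
      rw [e1, e2, e3]
      module
    have h' := key
    rw [show (b * (b * a) - χ β α • (b * (a * b)) - (χ β β * χ β α) • (b * (a * b) - χ β α • (a * (b * b)))) = 0 from by rw [← h], smul_zero] at h'
    exact sub_eq_zero.mp h'

lemma uvec7_add {i m p : ℕ} (h : i ≤ m + 1) (h' : m ≤ p) :
    uvec i m + uvec (m + 1) p = uvec i p := by
  funext t
  simp only [uvec, Pi.add_apply]
  split_ifs <;> omega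

lemma uvec7_self (i : ℕ) : uvec i i = evec i := by
  funext t
  simp only [uvec, evec]
  split_ifs <;> omega

lemma xu7_self (χ : (ℕ → ℤ) → (ℕ → ℤ) → k) (x : ℕ → B) (i : ℕ) : xu χ x i i = x i := by
  rw [xu]; simp

lemma xu7_lt (χ : (ℕ → ℤ) → (ℕ → ℤ) → k) (x : ℕ → B) {i j : ℕ} (h : i < j) :
    xu χ x i j = bra χ (uvec i i) (xu χ x i i) (uvec (i + 1) j) (xu χ x (i + 1) j) := by
  rw [xu7_self, uvec7_self]
  conv_lhs => rw [xu]
  rw [dif_neg (by omega)]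

end aux7

/-- Lemma: `[x_{u_{ij}}, x_{u_{ip}}]_c = 0` for `i ≤ j < p`, and
`[x_{u_{ij}}, x_{u_{pj}}]_c = 0` for `i < p ≤ j`. -/
theorem stmt_7 {k : Type*} [Field k] {B : Type*} [Ring B] [Algebra k B]
    -- the braiding matrix, of standard type A_θ
    (θ : ℕ) (hθ : 2 ≤ θ) (q : ℕ → ℕ → k) (q0 : k) (hq00 : q0 ≠ 0) (hq01 : q0 ≠ 1)
    (hq : ∀ s t, 1 ≤ s → s ≤ θ → 1 ≤ t → t ≤ θ → q s t ≠ 0)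
    (hfar : ∀ s t, 1 ≤ s → s ≤ θ → 1 ≤ t → t ≤ θ → (s + 1 < t ∨ t + 1 < s) →
      q s t * q t s = 1)
    (hadjt : ∀ s, 1 ≤ s → s + 1 ≤ θ →
      q s (s + 1) * q (s + 1) s = q0 ∨ q s (s + 1) * q (s + 1) s = q0⁻¹)
    (hdiag : ∀ s, 1 ≤ s → s ≤ θ →
      (q s s = -1 ∧ (1 < s → s < θ →
          (q (s - 1) s * q s (s - 1)) * (q s (s + 1) * q (s + 1) s) = 1)) ∨
      (q s s ≠ -1 ∧ (q s s = q0 ∨ q s s = q0⁻¹) ∧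
        (s < θ → q s s * (q s (s + 1) * q (s + 1) s) = 1) ∧
        (1 < s → q s s * (q (s - 1) s * q s (s - 1)) = 1)))
    -- the associated bicharacter
    (χ : (ℕ → ℤ) → (ℕ → ℤ) → k)
    (hχ₁ : ∀ a b c, χ (a + b) c = χ a c * χ b c)
    (hχ₂ : ∀ a b c, χ a (b + c) = χ a b * χ a c)
    (hχq : ∀ s t, 1 ≤ s → s ≤ θ → 1 ≤ t → t ≤ θ → χ (evec s) (evec t) = q s t)
    -- the ℤ^θ-graded algebra B with its generators x_i of degree e_i
    (x : ℕ → B) (𝒜 : (ℕ → ℤ) → Submodule k B)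
    (hgr : ∀ (α β : ℕ → ℤ) (a b : B), a ∈ 𝒜 α → b ∈ 𝒜 β → a * b ∈ 𝒜 (α + β))
    (hxdeg : ∀ i, 1 ≤ i → i ≤ θ → x i ∈ 𝒜 (evec i))
    -- the relations assumed to hold in B
    (hnil : ∀ i, 1 ≤ i → i ≤ θ → q i i = -1 → x i ^ 2 = 0)
    (hrel1 : ∀ i j, 1 ≤ i → i ≤ θ → 1 ≤ j → j ≤ θ → (i + 1 < j ∨ j + 1 < i) →
      bra χ (evec i) (x i) (evec j) (x j) = 0)
    (hrel2 : ∀ i j, 1 ≤ i → i ≤ θ → 1 ≤ j → j ≤ θ → (i + 1 = j ∨ j + 1 = i) →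
      bra χ (evec i) (x i) (evec i + evec j) (bra χ (evec i) (x i) (evec j) (x j)) = 0)
    (hrel3 : ∀ i, 1 ≤ i → i + 2 ≤ θ →
      bra χ (evec i + (evec (i + 1) + evec (i + 2)))
        (bra χ (evec i) (x i) (evec (i + 1) + evec (i + 2))
          (bra χ (evec (i + 1)) (x (i + 1)) (evec (i + 2)) (x (i + 2))))
        (evec (i + 1)) (x (i + 1)) = 0) :
    (∀ i j p, 1 ≤ i → i ≤ j → j < p → p ≤ θ →
      bra χ (uvec i j) (xu χ x i j) (uvec i p) (xu χ x i p) = 0) ∧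
    (∀ i p j, 1 ≤ i → i < p → p ≤ j → j ≤ θ →
      bra χ (uvec i j) (xu χ x i j) (uvec p j) (xu χ x p j) = 0) := by
  classical
  -- abbreviations
  let D : ℕ → ℕ → ℕ → ℕ → Prop := fun i j s t =>
    C7 χ (uvec i j) (xu χ x i j) (uvec s t) (xu χ x s t)
  have far0 : ∀ s t, 1 ≤ s → s ≤ θ → 1 ≤ t → t ≤ θ → (s + 1 < t ∨ t + 1 < s) → D s s t t := by
    intro s t h1 h2 h3 h4 h5
    simp only [D, uvec7_self, xu7_self]
    exact (C7_iff _ _ _ _ _).1 (hrel1 s t h1 h2 h3 h4 h5)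
  have farR : ∀ n s i j, j = i + n → 1 ≤ s → s ≤ θ → 1 ≤ i → j ≤ θ → (s + 1 < i ∨ j + 1 < s) →
      D s s i j := by
    intro n
    induction n with
    | zero =>
              intro s i j hj h1 h2 h3 h4 h5
              obtain rfl : i = j := by omega
              exact far0 s i h1 h2 h3 h4 h5
    | succ n ih =>
      intro s i j hj h1 h2 h3 h4 h5
      simp only [D]
      rw [xu7_lt χ x (show i < j by omega), ← uvec7_add (show i ≤ i + 1 by omega) (show i ≤ j by omega)]
      exact C7_right hχ₂ (far0 s i h1 h2 h3 (by omega) (by omega))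
        (ih s (i+1) j (by omega) h1 h2 (by omega) h4 (by omega))
  have farL : ∀ n s i j, j = i + n → 1 ≤ s → s ≤ θ → 1 ≤ i → j ≤ θ → (s + 1 < i ∨ j + 1 < s) →
      D i j s s := by
    intro n
    induction n with
    | zero =>
              intro s i j hj h1 h2 h3 h4 h5
              obtain rfl : i = j := by omega
              exact far0 i s h3 h4 h1 h2 (by omega)
    | succ n ih =>
      intro s i j hj h1 h2 h3 h4 h5
      simp only [D]
      rw [xu7_lt χ x (show i < j by omega), ← uvec7_add (show i ≤ i + 1 by omega) (show i ≤ j by omega)]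
      exact C7_left hχ₁ (far0 i s h3 (by omega) h1 h2 (by omega))
        (ih s (i+1) j (by omega) h1 h2 (by omega) h4 (by omega))
  have dec : ∀ n i m p, m = i + n → 1 ≤ i → m < p → p ≤ θ →
      xu χ x i p = bra χ (uvec i m) (xu χ x i m) (uvec (m + 1) p) (xu χ x (m + 1) p) := by
    intro n
    induction n with
    | zero => intro i m p hm h1 h2 h3; subst hm; exact xu7_lt χ x h2
    | succ n ih =>
      intro i m p hm h1 h2 h3
      rw [xu7_lt χ x (show i < p by omega), ih (i+1) m p (by omega) (by omega) h2 h3,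
        ← uvec7_add (show i + 1 ≤ m + 1 by omega) (show m ≤ p by omega),
        bra7_assoc hχ₁ hχ₂ (farR _ i (m+1) p (by rw [Nat.add_sub_cancel' (by omega : m + 1 ≤ p)]) h1 (by omega) (by omega) h3 (by omega)),
        ← xu7_lt χ x (show i < m by omega), uvec7_add (by omega) (by omega)]
  -- splitting
  have splR : ∀ s t i m p, 1 ≤ i → i ≤ m → m < p → p ≤ θ → D s t i m → D s t (m+1) p → D s t i p := by
    intro s t i m p h1 h2 h3 h4 ha hb
    simp only [D]
    rw [dec _ i m p (Nat.add_sub_cancel' h2).symm h1 h3 h4,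
      ← uvec7_add (show i ≤ m + 1 by omega) (show m ≤ p by omega)]
    exact C7_right hχ₂ ha hb
  have splL : ∀ s t i m p, 1 ≤ i → i ≤ m → m < p → p ≤ θ → D i m s t → D (m+1) p s t → D i p s t := by
    intro s t i m p h1 h2 h3 h4 ha hb
    simp only [D]
    rw [dec _ i m p (Nat.add_sub_cancel' h2).symm h1 h3 h4,
      ← uvec7_add (show i ≤ m + 1 by omega) (show m ≤ p by omega)]
    exact C7_left hχ₁ ha hb
  have farR' : ∀ s i j, i ≤ j → 1 ≤ s → s ≤ θ → 1 ≤ i → j ≤ θ → (s + 1 < i ∨ j + 1 < s) →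
      D s s i j := fun s i j h => farR _ s i j (Nat.add_sub_cancel' h).symm
  have farL' : ∀ s i j, i ≤ j → 1 ≤ s → s ≤ θ → 1 ≤ i → j ≤ θ → (s + 1 < i ∨ j + 1 < s) →
      D i j s s := fun s i j h => farL _ s i j (Nat.add_sub_cancel' h).symm
  have u2 : ∀ i, uvec i (i+1) = evec i + evec (i+1) := by
    intro i
    rw [← uvec7_self i, ← uvec7_self (i+1), uvec7_add (by omega) (by omega)]
  have u3 : ∀ i, uvec i (i+2) = evec i + (evec (i+1) + evec (i+2)) := by
    intro i
    rw [← u2, ← uvec7_self i, uvec7_add (by omega) (by omega)]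
  have x2 : ∀ i, xu χ x i (i+1) = bra χ (evec i) (x i) (evec (i+1)) (x (i+1)) := by
    intro i
    rw [xu7_lt χ x (show i < i+1 by omega)]
    simp only [uvec7_self, xu7_self]
  have x3 : ∀ i, xu χ x i (i+2) = bra χ (evec i) (x i) (evec (i+1) + evec (i+2))
      (bra χ (evec (i+1)) (x (i+1)) (evec (i+2)) (x (i+2))) := by
    intro i
    rw [xu7_lt χ x (show i < i+2 by omega), ← u2, ← x2]
    simp only [uvec7_self, xu7_self]
  -- base cases
  have b1 : ∀ i, 1 ≤ i → i + 1 ≤ θ → D i i i (i+1) := by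
    intro i h1 h2
    simp only [D, uvec7_self, xu7_self, u2, x2]
    exact (C7_iff _ _ _ _ _).1 (hrel2 i (i+1) h1 (by omega) (by omega) h2 (by omega))
  have b2 : ∀ i, 1 ≤ i → i + 1 ≤ θ → D i (i+1) (i+1) (i+1) := by
    intro i h1 h2
    simp only [D, uvec7_self, xu7_self, u2, x2]
    apply serre7 hχ₁ hχ₂ (hrel2 (i+1) i (by omega) h2 h1 (by omega) (by omega))
    rw [hχq _ _ (by omega) h2 (by omega) h2, hχq _ _ h1 (by omega) (by omega) h2,
      hχq _ _ (by omega) h2 h1 (by omega)]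
    rcases hdiag (i+1) (by omega) h2 with ⟨h, _⟩ | ⟨_, _, _, h⟩
    · exact Or.inl ⟨h, hnil _ (by omega) h2 h⟩
    · exact Or.inr (h (by omega))
  have b3 : ∀ i, 1 ≤ i → i + 2 ≤ θ → D i (i+2) (i+1) (i+1) := by
    intro i h1 h2
    simp only [D, uvec7_self, xu7_self, u3, x3]
    exact (C7_iff _ _ _ _ _).1 (hrel3 i h1 h2)
  have b4 : ∀ i, 1 ≤ i → i + 2 ≤ θ → D (i+1) (i+1) i (i+2) := by
    intro i h1 h2
    apply C7_flip (b3 i h1 h2)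
    rw [uvec7_self, u3]
    simp only [hχ₁, hχ₂]
    rw [hχq _ _ (by omega) (by omega) (by omega) (by omega),
      hχq _ _ (by omega) (by omega) (by omega) (by omega),
      hχq _ _ (by omega) (by omega) (by omega) (by omega),
      hχq _ _ (by omega) (by omega) (by omega) (by omega),
      hχq _ _ (by omega) (by omega) (by omega) (by omega)]
    rcases hdiag (i+1) (by omega) (by omega) with ⟨h, h'⟩ | ⟨_, _, h, h'⟩
    · have h' := h' (by omega) (by omega)
      simp only [Nat.add_sub_cancel] at h'
      rw [h]
      linear_combination h'
    · have h' := h' (by omega)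
      have h := h (by omega)
      simp only [Nat.add_sub_cancel] at h'
      linear_combination h' * (q (i+1) (i+1) * (q (i + 1) (i + 1 + 1) * q (i + 1 + 1) (i + 1))) + h
  -- one generator against a root vector
  have g1 : ∀ t i p, 1 ≤ i → i ≤ t → t < p → p ≤ θ → D t t i p := by
    have st : ∀ t p, 1 ≤ t → t < p → p ≤ θ → D t t t p := by
      intro t p h1 h2 h3
      rcases Nat.lt_or_ge (t+1) p with h | h
      · exact splR _ _ _ (t+1) _ h1 (by omega) h h3 (b1 t h1 (by omega))
          (farR' _ _ _ (by omega) h1 (by omega) (by omega) h3 (by omega))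
      · obtain rfl : p = t+1 := by omega
        exact b1 t h1 h3
    have st2 : ∀ i p, 1 ≤ i → i + 1 < p → p ≤ θ → D (i+1) (i+1) i p := by
      intro i p h1 h2 h3
      rcases Nat.lt_or_ge (i+2) p with h | h
      · exact splR _ _ _ (i+2) _ h1 (by omega) h h3 (b4 i h1 (by omega))
          (farR' _ _ _ (by omega) (by omega) (by omega) (by omega) h3 (by omega))
      · obtain rfl : p = i+2 := by omega
        exact b4 i h1 h3
    intro t i p h1 h2 h3 h4
    rcases Nat.lt_or_ge i t with h | h
    · obtain ⟨s, rfl⟩ : ∃ s, t = s + 1 := ⟨t - 1, by omega⟩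
      rcases Nat.lt_or_ge i s with h' | h'
      · obtain ⟨r, rfl⟩ : ∃ r, s = r + 1 := ⟨s - 1, by omega⟩
        exact splR _ _ _ r _ h1 (by omega) (by omega) h4
          (farR' _ _ _ (by omega) (by omega) (by omega) h1 (by omega) (by omega))
          (st2 (r+1) p (by omega) h3 h4)
      · obtain rfl : i = s := by omega
        exact st2 i p h1 h3 h4
    · obtain rfl : i = t := by omega
      exact st i p h1 h3 h4
  have g2 : ∀ t i j, 1 ≤ i → i < t → t ≤ j → j ≤ θ → D i j t t := by
    have st : ∀ t i, 1 ≤ i → i ≤ t → t + 1 ≤ θ → D i (t+1) (t+1) (t+1) := by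
      intro t i h1 h2 h3
      rcases Nat.lt_or_ge i t with h | h
      · obtain ⟨r, rfl⟩ : ∃ r, t = r + 1 := ⟨t - 1, by omega⟩
        exact splL _ _ _ r _ h1 (by omega) (by omega) h3
          (farL' _ _ _ (by omega) (by omega) h3 h1 (by omega) (by omega))
          (b2 (r+1) (by omega) h3)
      · obtain rfl : i = t := by omega
        exact b2 i h1 h3
    have st2 : ∀ i p, 1 ≤ i → i + 1 < p → p ≤ θ → D i p (i+1) (i+1) := by
      intro i p h1 h2 h3
      rcases Nat.lt_or_ge (i+2) p with h | h
      · exact splL _ _ _ (i+2) _ h1 (by omega) h h3 (b3 i h1 (by omega))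
          (farL' _ _ _ (by omega) (by omega) (by omega) (by omega) h3 (by omega))
      · obtain rfl : p = i+2 := by omega
        exact b3 i h1 h3
    intro t i p h1 h2 h3 h4
    obtain ⟨s, rfl⟩ : ∃ s, t = s + 1 := ⟨t - 1, by omega⟩
    rcases Nat.lt_or_ge (s+1) p with h | h
    · rcases Nat.lt_or_ge i s with h' | h'
      · obtain ⟨r, rfl⟩ : ∃ r, s = r + 1 := ⟨s - 1, by omega⟩
        exact splL _ _ _ r _ h1 (by omega) (by omega) h4
          (farL' _ _ _ (by omega) (by omega) (by omega) h1 (by omega) (by omega))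
          (st2 (r+1) p (by omega) h h4)
      · obtain rfl : i = s := by omega
        exact st2 i p h1 h h4
    · obtain rfl : p = s + 1 := by omega
      exact st s i h1 (by omega) h4
  have f1 : ∀ n s j i p, j = s + n → 1 ≤ i → i ≤ s → j < p → p ≤ θ → D s j i p := by
    intro n
    induction n with
    | zero =>
              intro s j i p hj h1 h2 h3 h4
              obtain rfl : s = j := by omega
              exact g1 s i p h1 h2 h3 h4
    | succ n ih =>
      intro s j i p hj h1 h2 h3 h4
      exact splL _ _ _ s _ (by omega) le_rfl (by omega) (by omega)
        (g1 s i p h1 h2 (by omega) h4) (ih (s+1) j i p (by omega) h1 (by omega) h3 h4)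
  have f2 : ∀ n s t i j, t = s + n → 1 ≤ i → i < s → t ≤ j → j ≤ θ → D i j s t := by
    intro n
    induction n with
    | zero =>
              intro s t i j hj h1 h2 h3 h4
              obtain rfl : s = t := by omega
              exact g2 s i j h1 h2 h3 h4
    | succ n ih =>
      intro s t i j hj h1 h2 h3 h4
      exact splR _ _ _ s _ (by omega) le_rfl (by omega) (by omega)
        (g2 s i j h1 h2 (by omega) h4) (ih (s+1) t i j (by omega) h1 (by omega) h3 h4)
  refine ⟨fun i j p h1 h2 h3 h4 => ?_, fun i p j h1 h2 h3 h4 => ?_⟩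
  · exact (C7_iff _ _ _ _ _).2 (f1 _ i j i p (Nat.add_sub_cancel' h2).symm h1 le_rfl h3 h4)
  · exact (C7_iff _ _ _ _ _).2 (f2 _ p j i j (Nat.add_sub_cancel' h3).symm h1 h2 le_rfl h4)
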